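/- arXiv:2010.11002 — 3 statements merged into one kernel-verified Lean document; each statement's English description precedes it below -/
import Mathlib

section
/- Under weak overlap, for every bounded measurable h: [K]×S×A → ℝ satisfying the constraint (*) and every bounded measurable g: S×A → ℝ, the variance of the estimator Γ(D;h,g) satisfies var[Γ(D;h,g)] ≥ V*/n, where V* = E_{π_*}[(π^e(a|s)/π_*(a|s))² σ_r²(s,a)] + var_{p_S}[v(s)]. -/
open MeasureTheory ProbabilityTheory BigOperators Filter
open scoped NNReal ENNReal

noncomputable section

/-- Joint law of an observation `(s, a, r)` when contexts are drawn from `pS`, actions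
from the policy `π`, and rewards from the reward kernel `pR`. -/
def obsMeasure {S A : Type*} [MeasurableSpace S] [MeasurableSpace A] [Fintype A]
    (pS : Measure S) (π : S → A → ℝ) (pR : S → A → Measure ℝ) :
    Measure (S × A × ℝ) :=
  pS.bind fun s => ∑ a : A, ENNReal.ofReal (π s a) • (pR s a).map (fun r => (s, a, r))

lemma obsK_meas {S A : Type*} [MeasurableSpace S] [MeasurableSpace A] [Fintype A]
    [MeasurableSingletonClass A]
    (pR : S → A → Measure ℝ) (hRprob : ∀ s a, IsProbabilityMeasure (pR s a))
    (hRmeas : Measurable fun p : S × A => pR p.1 p.2)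
    (π : S → A → ℝ) (hπ : ∀ a, Measurable fun s => π s a) :
    Measurable (fun s => ∑ a : A, ENNReal.ofReal (π s a) • (pR s a).map (fun r => (s, a, r))) := by
  refine Measure.measurable_of_measurable_coe _ fun t ht => ?_
  simp only [Measure.coe_finsetSum, Finset.sum_apply, Measure.smul_apply, smul_eq_mul]
  refine Finset.measurable_sum _ fun a _ => ?_
  refine (hπ a).ennreal_ofReal.mul ?_
  let κ : Kernel S ℝ := ⟨fun s => pR s a, hRmeas.comp (measurable_id.prodMk measurable_const)⟩
  have : IsMarkovKernel κ := ⟨fun s => hRprob s a⟩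
  have ht' : MeasurableSet ((fun p : S × ℝ => (p.1, a, p.2)) ⁻¹' t) :=
    (by fun_prop : Measurable (fun p : S × ℝ => (p.1, a, p.2))) ht
  have := Kernel.measurable_kernel_prodMk_left (κ := κ) ht'
  convert this using 2 with s
  rw [Measure.map_apply (by fun_prop) ht]
  rfl

lemma obs_facts {S A : Type*} [MeasurableSpace S] [MeasurableSpace A] [Fintype A]
    [MeasurableSingletonClass A]
    (pS : Measure S) [IsProbabilityMeasure pS]
    (pR : S → A → Measure ℝ) (hRprob : ∀ s a, IsProbabilityMeasure (pR s a))
    (hRmeas : Measurable fun p : S × A => pR p.1 p.2)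
    (Rmax : ℝ) (hRbdd : ∀ s a, ∀ᵐ r ∂ pR s a, r ∈ Set.Icc (0 : ℝ) Rmax)
    (π : S → A → ℝ) (hπ : ∀ a, Measurable fun s => π s a)
    (hnn : ∀ s a, 0 ≤ π s a) (hsum : ∀ s, ∑ a, π s a = 1) :
    IsProbabilityMeasure (obsMeasure pS π pR) ∧
    (∀ᵐ x ∂ obsMeasure pS π pR, x.2.2 ∈ Set.Icc (0 : ℝ) Rmax) ∧
    ∀ f : S × A × ℝ → ℝ, Measurable f → Integrable f (obsMeasure pS π pR) →
      (∀ s a, Integrable (fun r => f (s, a, r)) (pR s a)) →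
      ∫ x, f x ∂ obsMeasure pS π pR = ∫ s, ∑ a, π s a * ∫ r, f (s, a, r) ∂ pR s a ∂ pS := by
  let κ : Kernel S (S × A × ℝ) := ⟨_, obsK_meas pR hRprob hRmeas π hπ⟩
  have hκ : ∀ s, κ s = ∑ a : A, ENNReal.ofReal (π s a) • (pR s a).map (fun r => (s, a, r)) :=
    fun s => rfl
  have hobs : obsMeasure pS π pR = (κ ∘ₖ Kernel.const Unit pS) () := by
    rw [Kernel.comp_apply]; rfl
  have hM : IsMarkovKernel κ := ⟨fun s => ⟨by
    rw [hκ]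
    simp only [Measure.coe_finsetSum, Finset.sum_apply, Measure.smul_apply, smul_eq_mul]
    have : ∀ a, (Measure.map (fun r => (s, a, r)) (pR s a)) Set.univ = 1 := fun a => by
      rw [Measure.map_apply (by fun_prop) MeasurableSet.univ]; simp
    simp only [this, mul_one]
    rw [← ENNReal.ofReal_sum_of_nonneg fun a _ => hnn s a, hsum]; simp⟩⟩
  rw [hobs]
  refine ⟨inferInstance, ?_, fun f hf hfi hfr => ?_⟩
  · refine Kernel.ae_comp_of_ae_ae (measurable_snd.snd measurableSet_Icc) (ae_of_all _ fun s => ?_)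
    rw [hκ, ae_finsetSum_measure_iff]
    intro a _
    refine Measure.ae_smul_measure ?_ _
    rw [ae_map_iff (by fun_prop) (measurable_snd.snd measurableSet_Icc)]
    exact hRbdd s a
  · rw [Kernel.integral_comp hfi]
    simp only [Kernel.const_apply]
    congr 1 with s
    have hint : ∀ a, Integrable f (Measure.map (fun r => (s, a, r)) (pR s a)) := fun a => by
      rw [integrable_map_measure hf.aestronglyMeasurable (by fun_prop)]
      exact hfr s a
    rw [hκ, integral_finsetSum_measure fun a _ => (hint a).smul_measure (by simp)]
    refine Finset.sum_congr rfl fun a _ => ?_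
    rw [integral_smul_measure, integral_map (by fun_prop) hf.aestronglyMeasurable,
      ENNReal.toReal_ofReal (hnn s a), smul_eq_mul]

lemma reward_facts {S A : Type*} [MeasurableSpace S] [MeasurableSpace A]
    (pR : S → A → Measure ℝ) (hRprob : ∀ s a, IsProbabilityMeasure (pR s a))
    (hRmeas : Measurable fun p : S × A => pR p.1 p.2)
    (Rmax : ℝ) (hRbdd : ∀ s a, ∀ᵐ r ∂ pR s a, r ∈ Set.Icc (0 : ℝ) Rmax)
    (q : S → A → ℝ) (hq : ∀ s a, q s a = ∫ r, r ∂ pR s a)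
    (σ2 : S → A → ℝ) (hσ2 : ∀ s a, σ2 s a = variance id (pR s a)) :
    (Measurable fun p : S × A => q p.1 p.2) ∧ (∀ s a, |q s a| ≤ Rmax) ∧
    (Measurable fun p : S × A => σ2 p.1 p.2) ∧ (∀ s a, 0 ≤ σ2 s a ∧ σ2 s a ≤ Rmax ^ 2) ∧
    (∀ s a, Integrable (fun r => r) (pR s a) ∧ Integrable (fun r => r ^ 2) (pR s a)) ∧
    (∀ s a, ∫ r, r ^ 2 ∂ pR s a = σ2 s a + q s a ^ 2) := by
  let κ : Kernel (S × A) ℝ := ⟨fun p => pR p.1 p.2, hRmeas⟩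
  have hM : IsMarkovKernel κ := ⟨fun p => hRprob p.1 p.2⟩
  have hL : ∀ s a, MemLp (fun r => r) 2 (pR s a) := fun s a =>
    MemLp.of_bound measurable_id.aestronglyMeasurable Rmax (by
      filter_upwards [hRbdd s a] with r hr
      rw [Real.norm_eq_abs, abs_of_nonneg hr.1]; exact hr.2)
  have hI : ∀ s a, Integrable (fun r => r) (pR s a) ∧ Integrable (fun r => r ^ 2) (pR s a) :=
    fun s a => ⟨(hL s a).integrable (by norm_num), (hL s a).integrable_sq⟩
  have hv : ∀ s a, σ2 s a = ∫ r, r ^ 2 ∂ pR s a - q s a ^ 2 := fun s a => by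
    rw [hσ2, hq]
    exact variance_eq_sub (X := fun r : ℝ => r) (hL s a)
  have hqm : Measurable fun p : S × A => q p.1 p.2 := by
    have := (StronglyMeasurable.integral_kernel (κ := κ)
      (measurable_id (α := ℝ)).stronglyMeasurable).measurable
    simp only [hq]; exact this
  have hsm : Measurable fun p : S × A => ∫ r, r ^ 2 ∂ pR p.1 p.2 :=
    (StronglyMeasurable.integral_kernel (κ := κ)
      ((measurable_id (α := ℝ)).pow_const 2).stronglyMeasurable).measurable
  refine ⟨hqm, fun s a => ?_, ?_, fun s a => ⟨?_, ?_⟩, hI, fun s a => by rw [hv]; ring⟩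
  · rw [hq]
    have := norm_integral_le_of_norm_le_const (μ := pR s a) (f := fun r => r) (C := Rmax) (by
      filter_upwards [hRbdd s a] with r hr
      rw [Real.norm_eq_abs, abs_of_nonneg hr.1]; exact hr.2)
    simpa using this
  · simp only [hv]
    exact hsm.sub (hqm.pow_const 2)
  · rw [hσ2]; exact variance_nonneg _ _
  · rw [hv]
    have := norm_integral_le_of_norm_le_const (μ := pR s a) (f := fun r => r ^ 2)
      (C := Rmax ^ 2) (by
      filter_upwards [hRbdd s a] with r hr
      rw [Real.norm_eq_abs, abs_of_nonneg (sq_nonneg r)]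
      exact pow_le_pow_left₀ hr.1 hr.2 2)
    have h2 := (le_abs_self _).trans this
    simp only [probReal_univ, mul_one] at h2
    nlinarith [sq_nonneg (q s a)]

lemma stratum {S A : Type*} [MeasurableSpace S] [MeasurableSpace A] [Fintype A]
    [MeasurableSingletonClass A]
    (pS : Measure S) [IsProbabilityMeasure pS]
    (pR : S → A → Measure ℝ) (hRprob : ∀ s a, IsProbabilityMeasure (pR s a))
    (hRmeas : Measurable fun p : S × A => pR p.1 p.2)
    (Rmax : ℝ) (hRbdd : ∀ s a, ∀ᵐ r ∂ pR s a, r ∈ Set.Icc (0 : ℝ) Rmax)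
    (π : S → A → ℝ) (hπ : ∀ a, Measurable fun s => π s a)
    (hnn : ∀ s a, 0 ≤ π s a) (hsum : ∀ s, ∑ a, π s a = 1)
    (q : S → A → ℝ) (hq : ∀ s a, q s a = ∫ r, r ∂ pR s a)
    (σ2 : S → A → ℝ) (hσ2 : ∀ s a, σ2 s a = variance id (pR s a))
    (w : S → A → ℝ) (hw : Measurable fun p : S × A => w p.1 p.2)
    (Bw : ℝ) (hwb : ∀ s a, |w s a| ≤ Bw)
    (g : S → A → ℝ) (hg : Measurable fun p : S × A => g p.1 p.2)
    (Bg : ℝ) (hgb : ∀ s a, |g s a| ≤ Bg)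
    (G : S → ℝ) (hG : Measurable G) (BG : ℝ) (hGb : ∀ s, |G s| ≤ BG) :
    MemLp (fun x : S × A × ℝ => w x.1 x.2.1 * (x.2.2 - g x.1 x.2.1) + G x.1) 2
      (obsMeasure pS π pR) ∧
    MemLp (fun s => ∑ a, π s a * (w s a * (q s a - g s a)) + G s) 2 pS ∧
    Integrable (fun s => ∑ a, π s a * (w s a ^ 2 * σ2 s a)) pS ∧
    ∫ s, ∑ a, π s a * (w s a ^ 2 * σ2 s a) ∂ pS +
      variance (fun s => ∑ a, π s a * (w s a * (q s a - g s a)) + G s) pS ≤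
    variance (fun x : S × A × ℝ => w x.1 x.2.1 * (x.2.2 - g x.1 x.2.1) + G x.1)
      (obsMeasure pS π pR) := by
  obtain ⟨hprob, hae, hform⟩ := obs_facts pS pR hRprob hRmeas Rmax hRbdd π hπ hnn hsum
  obtain ⟨hqm, hqb, hsm, hsb, hI, hsq⟩ := reward_facts pR hRprob hRmeas Rmax hRbdd q hq σ2 hσ2
  have sec : ∀ {f : S → A → ℝ}, Measurable (fun p : S × A => f p.1 p.2) →
      ∀ a, Measurable fun s => f s a := fun hf a =>
    hf.comp (measurable_id.prodMk measurable_const)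
  have hp1 : ∀ s a, π s a ≤ 1 := fun s a => by
    rw [← hsum s]; exact Finset.single_le_sum (fun b _ => hnn s b) (Finset.mem_univ a)
  have key : ∀ s a r, |r| ≤ Rmax →
      |w s a * (r - g s a) + G s| ≤ Bw * (Rmax + Bg) + BG := fun s a r hr => by
    refine (abs_add_le _ _).trans (add_le_add ?_ (hGb s))
    rw [abs_mul]
    exact mul_le_mul (hwb s a) ((abs_sub _ _).trans (add_le_add hr (hgb s a))) (abs_nonneg _)
      ((abs_nonneg _).trans (hwb s a))
  set X : S × A × ℝ → ℝ := fun x => w x.1 x.2.1 * (x.2.2 - g x.1 x.2.1) + G x.1 with hX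
  set m : S → ℝ := fun s => ∑ a, π s a * (w s a * (q s a - g s a)) + G s with hm
  have hsa : Measurable fun x : S × A × ℝ => (x.1, x.2.1) := by fun_prop
  have hXm : Measurable X :=
    ((hw.comp hsa).mul (measurable_snd.snd.sub (hg.comp hsa))).add (hG.comp measurable_fst)
  have hXL : MemLp X 2 (obsMeasure pS π pR) :=
    MemLp.of_bound hXm.aestronglyMeasurable (Bw * (Rmax + Bg) + BG) (by
      filter_upwards [hae] with x hx
      exact key _ _ _ (by rw [abs_of_nonneg hx.1]; exact hx.2))
  have hmm : Measurable m :=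
    (Finset.measurable_sum _ fun a _ => (hπ a).mul
      ((sec hw a).mul ((sec hqm a).sub (sec hg a)))).add hG
  have hm' : ∀ s, m s = ∑ a, π s a * (w s a * (q s a - g s a) + G s) := fun s => by
    simp only [hm, mul_add, Finset.sum_add_distrib, ← Finset.sum_mul, hsum, one_mul]
  have hmL : MemLp m 2 pS :=
    MemLp.of_bound hmm.aestronglyMeasurable (Bw * (Rmax + Bg) + BG) (ae_of_all _ fun s => by
      rw [Real.norm_eq_abs, hm']
      calc _ ≤ ∑ a, |π s a * (w s a * (q s a - g s a) + G s)| := Finset.abs_sum_le_sum_abs _ _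
        _ ≤ ∑ a, π s a * (Bw * (Rmax + Bg) + BG) := Finset.sum_le_sum fun a _ => by
            rw [abs_mul, abs_of_nonneg (hnn s a)]
            exact mul_le_mul_of_nonneg_left (key s a _ (hqb s a)) (hnn s a)
        _ = _ := by rw [← Finset.sum_mul, hsum, one_mul])
  have hTi : Integrable (fun s => ∑ a, π s a * (w s a ^ 2 * σ2 s a)) pS := by
    refine integrable_finsetSum _ fun a _ => ?_
    refine Integrable.of_bound (((hπ a).mul (((sec hw a).pow_const 2).mul
      (sec hsm a))).aestronglyMeasurable) (1 * (Bw ^ 2 * Rmax ^ 2)) (ae_of_all _ fun s => ?_)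
    have h1 : 0 ≤ w s a ^ 2 * σ2 s a := mul_nonneg (sq_nonneg _) (hsb s a).1
    rw [Real.norm_eq_abs, abs_of_nonneg (mul_nonneg (hnn s a) h1)]
    refine mul_le_mul (hp1 s a) (mul_le_mul ?_ (hsb s a).2 (hsb s a).1 (sq_nonneg _)) h1 zero_le_one
    rw [← sq_abs]
    exact pow_le_pow_left₀ (abs_nonneg _) (hwb s a) 2
  refine ⟨hXL, hmL, hTi, ?_⟩
  have hlinI : ∀ s a, Integrable (fun r => w s a * (r - g s a)) (pR s a) := fun s a =>
    ((hI s a).1.sub (integrable_const _)).const_mul _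
  have hXI : ∀ s a, Integrable (fun r => X (s, a, r)) (pR s a) := fun s a =>
    (hlinI s a).add (integrable_const (G s))
  have hlin : ∀ s a, ∫ r, X (s, a, r) ∂ pR s a = w s a * (q s a - g s a) + G s := fun s a => by
    simp only [hX]
    rw [integral_add (hlinI s a) (integrable_const _),
      integral_const_mul, integral_sub (hI s a).1 (integrable_const _), hq]
    simp
  have hquadeq : ∀ s a, (fun r => X (s, a, r) ^ 2) = fun r =>
      w s a ^ 2 * r ^ 2 + 2 * w s a * (G s - w s a * g s a) * r + (G s - w s a * g s a) ^ 2 :=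
    fun s a => by
      funext r; simp only [hX]; ring
  have hquad : ∀ s a, ∫ r, X (s, a, r) ^ 2 ∂ pR s a =
      w s a ^ 2 * σ2 s a + (w s a * (q s a - g s a) + G s) ^ 2 := fun s a => by
    have h12 : Integrable (fun r => w s a ^ 2 * r ^ 2 + 2 * w s a * (G s - w s a * g s a) * r)
      (pR s a) := ((hI s a).2.const_mul _).add ((hI s a).1.const_mul _)
    rw [hquadeq, integral_add h12 (integrable_const _), integral_add ((hI s a).2.const_mul _) ((hI s a).1.const_mul _),
      integral_const_mul, integral_const_mul, hsq, ← hq]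
    simp only [integral_const, probReal_univ, smul_eq_mul]
    ring
  have hE1 : ∫ x, X x ∂ obsMeasure pS π pR = ∫ s, m s ∂ pS := by
    rw [hform X hXm (hXL.integrable (by norm_num)) hXI]
    simp only [hlin, hm']
  have hE2 : ∫ x, X x ^ 2 ∂ obsMeasure pS π pR =
      ∫ s, ∑ a, π s a * (w s a ^ 2 * σ2 s a + (w s a * (q s a - g s a) + G s) ^ 2) ∂ pS := by
    rw [hform (fun x => X x ^ 2) (hXm.pow_const 2) hXL.integrable_sq fun s a => by
      simp only [hquadeq s a]
      exact (((hI s a).2.const_mul _).add ((hI s a).1.const_mul _)).add (integrable_const _)]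
    simp only [hquad]
  have hQi : Integrable (fun s => ∑ a, π s a * (w s a * (q s a - g s a) + G s) ^ 2) pS := by
    refine integrable_finsetSum _ fun a _ => ?_
    refine Integrable.of_bound (((hπ a).mul ((((sec hw a).mul ((sec hqm a).sub (sec hg a))).add
      hG).pow_const 2)).aestronglyMeasurable) (1 * (Bw * (Rmax + Bg) + BG) ^ 2)
      (ae_of_all _ fun s => ?_)
    rw [Real.norm_eq_abs, abs_of_nonneg (mul_nonneg (hnn s a) (sq_nonneg _))]
    refine mul_le_mul (hp1 s a) ?_ (sq_nonneg _) zero_le_one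
    rw [← sq_abs]
    exact pow_le_pow_left₀ (abs_nonneg _) (key s a _ (hqb s a)) 2
  rw [variance_eq_sub hXL, variance_eq_sub hmL]
  simp only [Pi.pow_apply]
  rw [hE1, hE2]
  have hsplit : ∫ s, ∑ a, π s a * (w s a ^ 2 * σ2 s a + (w s a * (q s a - g s a) + G s) ^ 2) ∂ pS
      = ∫ s, ∑ a, π s a * (w s a ^ 2 * σ2 s a) ∂ pS +
        ∫ s, ∑ a, π s a * (w s a * (q s a - g s a) + G s) ^ 2 ∂ pS := by
    rw [← integral_add hTi hQi]
    simp only [mul_add, Finset.sum_add_distrib]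
  have hJ : ∫ s, m s ^ 2 ∂ pS ≤ ∫ s, ∑ a, π s a * (w s a * (q s a - g s a) + G s) ^ 2 ∂ pS := by
    refine integral_mono hmL.integrable_sq hQi fun s => ?_
    simp only [hm']
    have := Finset.sum_sq_le_sum_mul_sum_of_sq_le_mul Finset.univ
      (r := fun a => π s a * (w s a * (q s a - g s a) + G s)) (f := fun a => π s a)
      (g := fun a => π s a * (w s a * (q s a - g s a) + G s) ^ 2) (fun a _ => hnn s a)
      (fun a _ => mul_nonneg (hnn s a) (sq_nonneg _)) (fun a _ => (by ring : _ = _).le)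
    rwa [hsum, one_mul] at this
  linarith

/-- Under weak overlap, for every bounded measurable weight function
`h : [K]×S×A → ℝ` satisfying the constraint
`∑ k, ρ k * π_k(a|s) * h(k,s,a) = 1` whenever `π^e(a|s) > 0`, and every bounded
measurable control variate `g : S×A → ℝ`, the variance of the stratified estimator
`Γ(D;h,g)` satisfies `var[Γ(D;h,g)] ≥ V*/n`, where
`V* = E_{π_*}[(π^e/π_*)² σ_r²(s,a)] + var_{p_S}[v(s)]`. -/
theorem stmt1 {S A : Type*} [MeasurableSpace S] [MeasurableSpace A] [Fintype A]
    [MeasurableSingletonClass A]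
    (K : ℕ) (pS : Measure S) [IsProbabilityMeasure pS]
    (pR : S → A → Measure ℝ) (hRprob : ∀ s a, IsProbabilityMeasure (pR s a))
    (hRmeas : Measurable fun p : S × A => pR p.1 p.2)
    (Rmax : ℝ) (hRbdd : ∀ s a, ∀ᵐ r ∂ pR s a, r ∈ Set.Icc (0 : ℝ) Rmax)
    (πk : Fin K → S → A → ℝ) (πe : S → A → ℝ)
    (hπkmeas : ∀ k a, Measurable fun s => πk k s a)
    (hπemeas : ∀ a, Measurable fun s => πe s a)
    (hπknn : ∀ k s a, 0 ≤ πk k s a) (hπksum : ∀ k s, ∑ a, πk k s a = 1)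
    (hπenn : ∀ s a, 0 ≤ πe s a) (hπesum : ∀ s, ∑ a, πe s a = 1)
    -- stratum sizes and proportions
    (nk : Fin K → ℕ) (hn : 0 < ∑ k, nk k)
    (ρ : Fin K → ℝ) (hρ : ∀ k, ρ k = (nk k : ℝ) / (∑ k, nk k : ℕ))
    -- marginal logging policy
    (πstar : S → A → ℝ) (hπstar : ∀ s a, πstar s a = ∑ k, ρ k * πk k s a)
    -- weak overlap
    (hov : ∀ s a, 0 < πe s a → 0 < πstar s a)
    -- true mean reward, conditional reward variance, value function
    (q : S → A → ℝ) (hq : ∀ s a, q s a = ∫ r, r ∂ pR s a)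
    (σ2 : S → A → ℝ) (hσ2 : ∀ s a, σ2 s a = variance id (pR s a))
    (v : S → ℝ) (hv : ∀ s, v s = ∑ a, πe s a * q s a)
    -- the efficiency bound `V*`
    (Vstar : ℝ)
    (hVstar : Vstar =
      (∫ x : S × A × ℝ,
          (if πe x.1 x.2.1 = 0 then 0 else πe x.1 x.2.1 / πstar x.1 x.2.1) ^ 2 *
            σ2 x.1 x.2.1
        ∂ obsMeasure pS πstar pR) + variance v pS)
    -- bounded measurable weights satisfying the constraint (*)
    (h : Fin K → S → A → ℝ)
    (hhmeas : ∀ k, Measurable fun p : S × A => h k p.1 p.2)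
    (Bh : ℝ) (hhbdd : ∀ k s a, |h k s a| ≤ Bh)
    (hcon : ∀ s a, 0 < πe s a → ∑ k, ρ k * πk k s a * h k s a = 1)
    -- bounded measurable control variate
    (g : S → A → ℝ) (hgmeas : Measurable fun p : S × A => g p.1 p.2)
    (Bg : ℝ) (hgbdd : ∀ s a, |g s a| ≤ Bg)
    -- the estimator `Γ(D; h, g)`
    (Γ : (((k : Fin K) × Fin (nk k)) → S × A × ℝ) → ℝ)
    (hΓ : ∀ ω, Γ ω =
      ((∑ k, nk k : ℕ) : ℝ)⁻¹ * ∑ i : (k : Fin K) × Fin (nk k),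
        (h i.1 (ω i).1 (ω i).2.1 * πe (ω i).1 (ω i).2.1 *
            ((ω i).2.2 - g (ω i).1 (ω i).2.1) +
          ∑ a, πe (ω i).1 a * g (ω i).1 a)) :
    Vstar / (∑ k, nk k : ℕ) ≤
      variance Γ
        (Measure.pi (fun i : (k : Fin K) × Fin (nk k) => obsMeasure pS (πk i.1) pR)) := by
  classical
  obtain ⟨hqm, hqb, hsm, hsb, hI, hsq⟩ := reward_facts pR hRprob hRmeas Rmax hRbdd q hq σ2 hσ2
  have hNpos : (0 : ℝ) < ((∑ k, nk k : ℕ) : ℝ) := by exact_mod_cast hn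
  set N : ℝ := ((∑ k, nk k : ℕ) : ℝ) with hN
  have hρnn : ∀ k, 0 ≤ ρ k := fun k => by rw [hρ]; positivity
  have hρsum : ∑ k, ρ k = 1 := by
    simp only [hρ, ← Finset.sum_div]
    rw [div_eq_one_iff_eq hNpos.ne', hN]; push_cast; rfl
  have hπe1 : ∀ s a, πe s a ≤ 1 := fun s a => by
    rw [← hπesum s]; exact Finset.single_le_sum (fun b _ => hπenn s b) (Finset.mem_univ a)
  have hπej : Measurable fun p : S × A => πe p.1 p.2 :=
    measurable_from_prod_countable_left hπemeas
  have hsmeas : ∀ a, Measurable fun s => πstar s a := fun a => by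
    simp only [hπstar]
    exact Finset.measurable_sum _ fun k _ => (hπkmeas k a).const_mul _
  have hsj : Measurable fun p : S × A => πstar p.1 p.2 :=
    measurable_from_prod_countable_left hsmeas
  have hsnn : ∀ s a, 0 ≤ πstar s a := fun s a => by
    rw [hπstar]; exact Finset.sum_nonneg fun k _ => mul_nonneg (hρnn k) (hπknn k s a)
  have hssum : ∀ s, ∑ a, πstar s a = 1 := fun s => by
    simp only [hπstar]
    rw [Finset.sum_comm]
    simp only [← Finset.mul_sum, hπksum, mul_one, hρsum]
  let G : S → ℝ := fun s => ∑ a, πe s a * g s a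
  have hgsec : ∀ a, Measurable fun s => g s a := fun a =>
    hgmeas.comp (measurable_id.prodMk measurable_const)
  have hG : Measurable G := Finset.measurable_sum _ fun a _ => (hπemeas a).mul (hgsec a)
  have hGb : ∀ s, |G s| ≤ Bg := fun s =>
    calc |G s| ≤ ∑ a, |πe s a * g s a| := Finset.abs_sum_le_sum_abs _ _
      _ ≤ ∑ a, πe s a * Bg := Finset.sum_le_sum fun a _ => by
          rw [abs_mul, abs_of_nonneg (hπenn s a)]
          exact mul_le_mul_of_nonneg_left (hgbdd s a) (hπenn s a)
      _ = Bg := by rw [← Finset.sum_mul, hπesum, one_mul]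
  let w : Fin K → S → A → ℝ := fun k s a => h k s a * πe s a
  have hw : ∀ k, Measurable fun p : S × A => w k p.1 p.2 := fun k => (hhmeas k).mul hπej
  have hwb : ∀ k s a, |w k s a| ≤ Bh := fun k s a => by
    simp only [w]
    rw [abs_mul, abs_of_nonneg (hπenn s a)]
    calc _ ≤ |h k s a| * 1 := mul_le_mul_of_nonneg_left (hπe1 s a) (abs_nonneg _)
      _ ≤ Bh := by rw [mul_one]; exact hhbdd k s a
  have hst := fun k => stratum pS pR hRprob hRmeas Rmax hRbdd (πk k) (hπkmeas k) (hπknn k)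
    (hπksum k) q hq σ2 hσ2 (w k) (hw k) Bh (hwb k) g hgmeas Bg hgbdd G hG Bg hGb
  choose hXL hmL hTi hvar using hst
  have hpr : ∀ k, IsProbabilityMeasure (obsMeasure pS (πk k) pR) := fun k =>
    (obs_facts pS pR hRprob hRmeas Rmax hRbdd (πk k) (hπkmeas k) (hπknn k) (hπksum k)).1
  let X : Fin K → S × A × ℝ → ℝ :=
    fun k x => w k x.1 x.2.1 * (x.2.2 - g x.1 x.2.1) + G x.1
  let m : Fin K → S → ℝ := fun k s => ∑ a, πk k s a * (w k s a * (q s a - g s a)) + G s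
  have hvG : variance Γ
        (Measure.pi (fun i : (k : Fin K) × Fin (nk k) => obsMeasure pS (πk i.1) pR)) =
      N⁻¹ * ∑ k, ρ k * variance (X k) (obsMeasure pS (πk k) pR) := by
    have hΓ' : Γ = fun ω => N⁻¹ *
        (∑ i : (k : Fin K) × Fin (nk k), fun ω : ((k : Fin K) × Fin (nk k)) → S × A × ℝ =>
          X i.1 (ω i)) ω := by
      funext ω
      rw [hΓ, Finset.sum_apply]
    rw [hΓ', variance_const_mul,
      variance_sum_pi (X := fun i : (k : Fin K) × Fin (nk k) => X i.1) fun i => hXL i.1,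
      Fintype.sum_sigma]
    simp only [Finset.sum_const, Finset.card_univ, Fintype.card_fin, nsmul_eq_mul]
    rw [Finset.mul_sum, Finset.mul_sum]
    refine Finset.sum_congr rfl fun k _ => ?_
    rw [hρ]
    field_simp
  rw [hvG, div_eq_inv_mul]
  refine mul_le_mul_of_nonneg_left ?_ (inv_nonneg.2 hNpos.le)
  have hA : ∑ k, ρ k * (∫ s, ∑ a, πk k s a * (w k s a ^ 2 * σ2 s a) ∂ pS + variance (m k) pS) ≤
      ∑ k, ρ k * variance (X k) (obsMeasure pS (πk k) pR) :=
    Finset.sum_le_sum fun k _ => mul_le_mul_of_nonneg_left (hvar k) (hρnn k)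
  refine le_trans ?_ hA
  simp only [mul_add, Finset.sum_add_distrib]
  rw [hVstar]
  refine add_le_add ?_ ?_
  · have hRHSi : Integrable
        (fun s => ∑ k, ρ k * ∑ a, πk k s a * (w k s a ^ 2 * σ2 s a)) pS :=
      integrable_finsetSum _ fun k _ => (hTi k).const_mul _
    have hRHS : ∑ k, ρ k * ∫ s, ∑ a, πk k s a * (w k s a ^ 2 * σ2 s a) ∂ pS =
        ∫ s, ∑ k, ρ k * ∑ a, πk k s a * (w k s a ^ 2 * σ2 s a) ∂ pS := by
      rw [integral_finsetSum _ fun k _ => (hTi k).const_mul _]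
      simp only [integral_const_mul]
    rw [hRHS]
    have hTnn : ∀ s, 0 ≤ ∑ k, ρ k * ∑ a, πk k s a * (w k s a ^ 2 * σ2 s a) := fun s =>
      Finset.sum_nonneg fun k _ => mul_nonneg (hρnn k) <| Finset.sum_nonneg fun a _ =>
        mul_nonneg (hπknn k s a) (mul_nonneg (sq_nonneg _) (hsb s a).1)
    by_cases hVi : Integrable (fun x : S × A × ℝ =>
          (if πe x.1 x.2.1 = 0 then 0 else πe x.1 x.2.1 / πstar x.1 x.2.1) ^ 2 *
            σ2 x.1 x.2.1) (obsMeasure pS πstar pR)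
    swap
    · rw [integral_undef hVi]; exact integral_nonneg hTnn
    have hsa : Measurable fun x : S × A × ℝ => (x.1, x.2.1) := by fun_prop
    have hpe : Measurable fun x : S × A × ℝ => πe x.1 x.2.1 := hπej.comp hsa
    have hVm : Measurable (fun x : S × A × ℝ =>
          (if πe x.1 x.2.1 = 0 then 0 else πe x.1 x.2.1 / πstar x.1 x.2.1) ^ 2 *
            σ2 x.1 x.2.1) :=
      ((Measurable.ite (hpe (measurableSet_singleton 0)) measurable_const
        (hpe.div (hsj.comp hsa))).pow_const 2).mul (hsm.comp hsa)
    rw [(obs_facts pS pR hRprob hRmeas Rmax hRbdd πstar hsmeas hsnn hssum).2.2 _ hVm hVi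
      fun s a => integrable_const
        ((if πe s a = 0 then 0 else πe s a / πstar s a) ^ 2 * σ2 s a)]
    refine integral_mono_of_nonneg (ae_of_all _ fun s => ?_) hRHSi (ae_of_all _ fun s => ?_)
    · refine Finset.sum_nonneg fun a _ => mul_nonneg (hsnn s a) (integral_nonneg fun r => ?_)
      exact mul_nonneg (sq_nonneg _) (hsb s a).1
    · simp only [integral_const, probReal_univ, one_smul]
      simp only [Finset.mul_sum]
      rw [Finset.sum_comm]
      refine Finset.sum_le_sum fun a _ => ?_
      by_cases he : πe s a = 0
      · simp [he, w]
      rw [if_neg he]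
      have hepos : 0 < πe s a := lt_of_le_of_ne (hπenn s a) (Ne.symm he)
      have hspos := hov s a hepos
      have hcs := Finset.sum_sq_le_sum_mul_sum_of_sq_le_mul Finset.univ
        (r := fun k => ρ k * πk k s a * h k s a) (f := fun k => ρ k * πk k s a)
        (g := fun k => ρ k * πk k s a * h k s a ^ 2)
        (fun k _ => mul_nonneg (hρnn k) (hπknn k s a))
        (fun k _ => mul_nonneg (mul_nonneg (hρnn k) (hπknn k s a)) (sq_nonneg _))
        (fun k _ => (by ring : _ = _).le)
      rw [hcon s a hepos, ← hπstar, one_pow] at hcs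
      have hR : ∑ k, ρ k * (πk k s a * (w k s a ^ 2 * σ2 s a)) =
          (πe s a ^ 2 * σ2 s a) * ∑ k, ρ k * πk k s a * h k s a ^ 2 := by
        rw [Finset.mul_sum]
        refine Finset.sum_congr rfl fun k _ => ?_
        simp only [w]; ring
      have hL : πstar s a * ((πe s a / πstar s a) ^ 2 * σ2 s a) =
          (πe s a ^ 2 * σ2 s a) * (1 / πstar s a) := by
        field_simp
      rw [hR, hL]
      refine mul_le_mul_of_nonneg_left ?_ (mul_nonneg (sq_nonneg _) (hsb s a).1)
      rw [div_le_iff₀ hspos, mul_comm]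
      exact hcs
  · have hvm : ∀ s, v s = ∑ k, ρ k * m k s := fun s => by
      have h1 : ∑ k, ρ k * m k s =
          ∑ a, (∑ k, ρ k * πk k s a * h k s a) * (πe s a * (q s a - g s a)) + G s := by
        simp only [m, mul_add, Finset.sum_add_distrib, ← Finset.sum_mul, hρsum, one_mul]
        congr 1
        simp only [Finset.mul_sum, Finset.sum_mul]
        rw [Finset.sum_comm]
        refine Finset.sum_congr rfl fun a _ => Finset.sum_congr rfl fun k _ => ?_
        simp only [w]; ring
      rw [h1, hv]
      simp only [G]
      rw [← Finset.sum_add_distrib]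
      refine Finset.sum_congr rfl fun a _ => ?_
      by_cases he : πe s a = 0
      · simp [he]
      rw [hcon s a (lt_of_le_of_ne (hπenn s a) (Ne.symm he))]
      ring
    have hmi : ∀ k, Integrable (m k) pS := fun k => (hmL k).integrable (by norm_num)
    have hEv : ∫ s, v s ∂ pS = ∑ k, ρ k * ∫ s, m k s ∂ pS := by
      simp only [hvm]
      rw [integral_finsetSum _ fun k _ => (hmi k).const_mul _]
      simp only [integral_const_mul]
    have hvmeas : AEMeasurable v pS := by
      have : v = fun s => ∑ k, ρ k * m k s := funext hvm
      rw [this]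
      exact Finset.aemeasurable_fun_sum _ fun k _ => (hmi k).aemeasurable.const_mul _
    have hdi : ∀ k, Integrable (fun s => (m k s - ∫ s, m k s ∂ pS) ^ 2) pS := fun k =>
      ((hmL k).sub (memLp_const _)).integrable_sq
    rw [variance_eq_integral hvmeas]
    have : ∑ k, ρ k * variance (m k) pS =
        ∫ s, ∑ k, ρ k * (m k s - ∫ s, m k s ∂ pS) ^ 2 ∂ pS := by
      rw [integral_finsetSum _ fun k _ => (hdi k).const_mul _]
      simp only [integral_const_mul]
      refine Finset.sum_congr rfl fun k _ => ?_
      rw [variance_eq_integral (hmi k).aemeasurable]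
    rw [this]
    refine integral_mono_of_nonneg (ae_of_all _ fun s => sq_nonneg _)
      (integrable_finsetSum _ fun k _ => (hdi k).const_mul _) (ae_of_all _ fun s => ?_)
    have hd : v s - ∫ s, v s ∂ pS = ∑ k, ρ k * (m k s - ∫ s, m k s ∂ pS) := by
      rw [hEv, hvm]; simp only [mul_sub, Finset.sum_sub_distrib]
    simp only [hd]
    have := Finset.sum_sq_le_sum_mul_sum_of_sq_le_mul Finset.univ
      (r := fun k => ρ k * (m k s - ∫ s, m k s ∂ pS)) (f := fun k => ρ k)
      (g := fun k => ρ k * (m k s - ∫ s, m k s ∂ pS) ^ 2) (fun k _ => hρnn k)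
      (fun k _ => mul_nonneg (hρnn k) (sq_nonneg _)) (fun k _ => (by ring : _ = _).le)
    rwa [hρsum, one_mul] at this
end
end

section
/- Under weak overlap, suppose π̂: S×A → ℝ and the marginal logging policy π_* both satisfy π̂(s,a) ≥ δ and π_*(a|s) ≥ δ for all (s,a) with π^e(a|s) > 0, for some δ > 0, and let ĝ: S×A → ℝ be bounded measurable. Then the bias of the plug-in doubly robust score satisfies the product bound | E_{π_*}[ (π^e/π̂)(r − ĝ) + ĝ(s,π^e) ] − J | ≤ (1/δ²) ‖π̂ − π_*‖₂ ‖ĝ − q‖₂, where ‖f‖₂ = (E_{π_*}[f(s,a)²])^{1/2} and ratios involving π^e are 0 whenever π^e(a|s) = 0. -/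
open MeasureTheory ProbabilityTheory BigOperators Filter
open scoped NNReal ENNReal

noncomputable section

lemma obs_kernel_meas {S A : Type*} [MeasurableSpace S] [MeasurableSpace A] [Fintype A]
    [MeasurableSingletonClass A]
    (pR : S → A → Measure ℝ) (hRprob : ∀ s a, IsProbabilityMeasure (pR s a))
    (hRmeas : Measurable fun p : S × A => pR p.1 p.2)
    (π : S → A → ℝ) (hπ : ∀ a, Measurable fun s => π s a) :
    Measurable fun s => ∑ a : A, ENNReal.ofReal (π s a) • (pR s a).map (fun r => (s, a, r)) := by
  refine Measure.measurable_of_measurable_coe _ fun E hE => ?_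
  have hm : ∀ s a, Measurable (fun r : ℝ => ((s, a, r) : S × A × ℝ)) := fun s a => by fun_prop
  simp only [Measure.coe_finsetSum, Finset.sum_apply, Measure.smul_apply, smul_eq_mul]
  refine Finset.measurable_sum _ fun a _ => ?_
  refine (hπ a).ennreal_ofReal.mul ?_
  let κ : Kernel S ℝ := ⟨fun s => pR s a, hRmeas.comp (by fun_prop : Measurable fun s : S => (s, a))⟩
  have : IsMarkovKernel κ := ⟨fun s => hRprob s a⟩
  have hE' : MeasurableSet ((fun p : S × ℝ => ((p.1, a, p.2) : S × A × ℝ)) ⁻¹' E) :=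
    (by fun_prop : Measurable fun p : S × ℝ => ((p.1, a, p.2) : S × A × ℝ)) hE
  have := Kernel.measurable_kernel_prodMk_left (κ := κ) hE'
  convert this using 1
  funext s
  rw [Measure.map_apply (hm s a) hE]
  rfl

lemma obs_key {S A : Type*} [MeasurableSpace S] [MeasurableSpace A] [Fintype A]
    [MeasurableSingletonClass A] (pS : Measure S) [IsProbabilityMeasure pS]
    (pR : S → A → Measure ℝ) (hRprob : ∀ s a, IsProbabilityMeasure (pR s a))
    (hRmeas : Measurable fun p : S × A => pR p.1 p.2)
    (π : S → A → ℝ) (hπ : ∀ a, Measurable fun s => π s a)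
    (hnn : ∀ s a, 0 ≤ π s a) (hsum : ∀ s, ∑ a, π s a = 1)
    (f : S × A × ℝ → ℝ) (hf : Measurable f) (C : ℝ)
    (hC : ∀ s a, ∀ᵐ r ∂ pR s a, |f (s, a, r)| ≤ C) :
    IsProbabilityMeasure (obsMeasure pS π pR) ∧
    (∀ᵐ x ∂ obsMeasure pS π pR, |f x| ≤ C) ∧
    Integrable f (obsMeasure pS π pR) ∧
    ∫ x, f x ∂ obsMeasure pS π pR = ∫ s, ∑ a, π s a * ∫ r, f (s, a, r) ∂ pR s a ∂ pS := by
  have hm : ∀ s a, Measurable (fun r : ℝ => ((s, a, r) : S × A × ℝ)) := fun s a => by fun_prop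
  let κ : Kernel S (S × A × ℝ) := ⟨_, obs_kernel_meas pR hRprob hRmeas π hπ⟩
  have hκ : ∀ s, κ s = ∑ a : A, ENNReal.ofReal (π s a) • (pR s a).map (fun r => (s, a, r)) :=
    fun s => rfl
  have : IsMarkovKernel κ := by
    refine ⟨fun s => ⟨?_⟩⟩
    rw [hκ]
    simp only [Measure.coe_finsetSum, Finset.sum_apply, Measure.smul_apply, smul_eq_mul]
    have : ∀ a, (Measure.map (fun r => ((s, a, r) : S × A × ℝ)) (pR s a)) Set.univ = 1 := by
      intro a
      rw [Measure.map_apply (hm s a) MeasurableSet.univ]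
      have := hRprob s a
      simp
    simp only [this, mul_one]
    rw [← ENNReal.ofReal_sum_of_nonneg (fun a _ => hnn s a), hsum, ENNReal.ofReal_one]
  have hobs : obsMeasure pS π pR = κ ∘ₘ pS := rfl
  have hset : MeasurableSet {x : S × A × ℝ | |f x| ≤ C} :=
    measurableSet_le (by fun_prop) (by fun_prop)
  have hae : ∀ᵐ x ∂ obsMeasure pS π pR, |f x| ≤ C := by
    rw [hobs, Measure.ae_comp_iff hset]
    refine ae_of_all _ fun s => ?_
    rw [hκ, ae_iff]
    simp only [Measure.coe_finsetSum, Finset.sum_apply, Measure.smul_apply, smul_eq_mul]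
    refine Finset.sum_eq_zero fun a _ => ?_
    rw [show {x | ¬ |f x| ≤ C} = {x | |f x| ≤ C}ᶜ from rfl,
      Measure.map_apply (hm s a) hset.compl]
    have := hC s a
    rw [ae_iff] at this
    rw [show (fun r => ((s, a, r) : S × A × ℝ)) ⁻¹' {x | |f x| ≤ C}ᶜ = {r | ¬ |f (s, a, r)| ≤ C}
      from rfl, this, mul_zero]
  have hprob : IsProbabilityMeasure (obsMeasure pS π pR) := by rw [hobs]; infer_instance
  have hint : Integrable f (obsMeasure pS π pR) :=
    Integrable.of_bound hf.aestronglyMeasurable C hae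
  refine ⟨hprob, hae, hint, ?_⟩
  rw [hobs] at hint ⊢
  rw [Measure.comp_eq_comp_const_apply] at hint ⊢
  rw [Kernel.integral_comp hint, Kernel.const_apply]
  refine integral_congr_ae (ae_of_all _ fun s => ?_)
  have hI : ∀ a, Integrable f ((pR s a).map (fun r => ((s, a, r) : S × A × ℝ))) := by
    intro a
    have := hRprob s a
    rw [integrable_map_measure hf.aestronglyMeasurable (hm s a).aemeasurable]
    exact Integrable.of_bound (hf.comp (hm s a)).aestronglyMeasurable C (hC s a)
  show ∫ x, f x ∂κ s = _
  rw [hκ, integral_finset_sum_measure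
    (fun a _ => (hI a).smul_measure ENNReal.ofReal_ne_top)]
  refine Finset.sum_congr rfl fun a _ => ?_
  rw [integral_smul_measure, integral_map (hm s a).aemeasurable hf.aestronglyMeasurable,
    ENNReal.toReal_ofReal (hnn s a), smul_eq_mul]

lemma obs_cs {X : Type*} [MeasurableSpace X] (μ : Measure X) [IsProbabilityMeasure μ]
    (f g h : X → ℝ) (hf : MemLp f 2 μ) (hg : MemLp g 2 μ) (c : ℝ) (hc : 0 ≤ c)
    (hh : ∀ x, |h x| ≤ c * (|f x| * |g x|)) :
    |∫ x, h x ∂μ| ≤ c * Real.sqrt (∫ x, f x ^ 2 ∂μ) * Real.sqrt (∫ x, g x ^ 2 ∂μ) := by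
  have hfg : Integrable (fun x => |f x| * |g x|) μ := MemLp.integrable_mul hf.abs hg.abs
  have h1 : |∫ x, h x ∂μ| ≤ ∫ x, c * (|f x| * |g x|) ∂μ :=
    norm_integral_le_of_norm_le (f := h) (hfg.const_mul c) (ae_of_all _ hh)
  have h2 := integral_mul_le_Lp_mul_Lq_of_nonneg (μ := μ) (f := fun x => |f x|)
    (g := fun x => |g x|) Real.HolderConjugate.two_two (ae_of_all _ fun x => abs_nonneg _)
    (ae_of_all _ fun x => abs_nonneg _) (by simp only [ENNReal.ofReal_ofNat]; exact hf.abs) (by simp only [ENNReal.ofReal_ofNat]; exact hg.abs)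
  simp only [Real.rpow_two, sq_abs, ← Real.sqrt_eq_rpow] at h2
  rw [integral_const_mul] at h1
  rw [mul_assoc]
  exact h1.trans (mul_le_mul_of_nonneg_left h2 hc)

/-- Under weak overlap, if both `π̂` and the marginal logging policy
`π_*` are bounded below by `δ > 0` on `{π^e > 0}` and `ĝ` is bounded measurable, then
the bias of the plug-in doubly robust score satisfies the product bound
`|E_{π_*}[(π^e/π̂)(r − ĝ) + ĝ(s,π^e)] − J| ≤ (1/δ²) ‖π̂ − π_*‖₂ ‖ĝ − q‖₂`,
with `‖f‖₂ = (E_{π_*}[f(s,a)²])^{1/2}` and ratios involving `π^e` equal to `0`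
whenever `π^e(a|s) = 0`. -/
theorem stmt11 {S A : Type*} [MeasurableSpace S] [MeasurableSpace A] [Fintype A]
    [MeasurableSingletonClass A]
    (K : ℕ) (pS : Measure S) [IsProbabilityMeasure pS]
    (pR : S → A → Measure ℝ) (hRprob : ∀ s a, IsProbabilityMeasure (pR s a))
    (hRmeas : Measurable fun p : S × A => pR p.1 p.2)
    (Rmax : ℝ) (hRbdd : ∀ s a, ∀ᵐ r ∂ pR s a, r ∈ Set.Icc (0 : ℝ) Rmax)
    (πk : Fin K → S → A → ℝ) (πe : S → A → ℝ)
    (hπkmeas : ∀ k a, Measurable fun s => πk k s a)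
    (hπemeas : ∀ a, Measurable fun s => πe s a)
    (hπknn : ∀ k s a, 0 ≤ πk k s a) (hπksum : ∀ k s, ∑ a, πk k s a = 1)
    (hπenn : ∀ s a, 0 ≤ πe s a) (hπesum : ∀ s, ∑ a, πe s a = 1)
    (ρ : Fin K → ℝ) (hρpos : ∀ k, 0 < ρ k) (hρsum : ∑ k, ρ k = 1)
    (πstar : S → A → ℝ) (hπstar : ∀ s a, πstar s a = ∑ k, ρ k * πk k s a)
    -- weak overlap
    (hov : ∀ s a, 0 < πe s a → 0 < πstar s a)
    (q : S → A → ℝ) (hq : ∀ s a, q s a = ∫ r, r ∂ pR s a)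
    (J : ℝ) (hJ : J = ∫ s, ∑ a, πe s a * q s a ∂ pS)
    -- the plug-in nuisances
    (πhat : S → A → ℝ) (hπhatmeas : ∀ a, Measurable fun s => πhat s a)
    (Bπ : ℝ) (hπhatbdd : ∀ s a, |πhat s a| ≤ Bπ)
    (δ : ℝ) (hδ : 0 < δ)
    (hπhatlb : ∀ s a, 0 < πe s a → δ ≤ πhat s a)
    (hπstarlb : ∀ s a, 0 < πe s a → δ ≤ πstar s a)
    (ghat : S → A → ℝ) (hghatmeas : Measurable fun p : S × A => ghat p.1 p.2)
    (B : ℝ) (hghatbdd : ∀ s a, |ghat s a| ≤ B) :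
    |(∫ x : S × A × ℝ,
        ((if πe x.1 x.2.1 = 0 then 0 else πe x.1 x.2.1 / πhat x.1 x.2.1) *
          (x.2.2 - ghat x.1 x.2.1) + ∑ a, πe x.1 a * ghat x.1 a)
      ∂ obsMeasure pS πstar pR) - J| ≤
    (1 / δ ^ 2) *
      Real.sqrt (∫ x : S × A × ℝ, (πhat x.1 x.2.1 - πstar x.1 x.2.1) ^ 2
        ∂ obsMeasure pS πstar pR) *
      Real.sqrt (∫ x : S × A × ℝ, (ghat x.1 x.2.1 - q x.1 x.2.1) ^ 2
        ∂ obsMeasure pS πstar pR) := by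
  have hρle : ∀ s, ∑ a, πstar s a = 1 := by
    intro s
    simp_rw [hπstar]
    rw [Finset.sum_comm]
    simp_rw [← Finset.mul_sum, hπksum, mul_one, hρsum]
  have hsnn : ∀ s a, 0 ≤ πstar s a := fun s a => by
    rw [hπstar]; exact Finset.sum_nonneg fun k _ => mul_nonneg (hρpos k).le (hπknn k s a)
  have hs1 : ∀ s a, πstar s a ≤ 1 := fun s a => by
    rw [← hρle s]
    exact Finset.single_le_sum (f := fun a => πstar s a) (fun a _ => hsnn s a) (Finset.mem_univ a)
  have he1 : ∀ s a, πe s a ≤ 1 := fun s a => by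
    rw [← hπesum s]
    exact Finset.single_le_sum (f := fun a => πe s a) (fun a _ => hπenn s a) (Finset.mem_univ a)
  have hsmeas : ∀ a, Measurable fun s => πstar s a := fun a => by
    simp_rw [hπstar]
    exact Finset.measurable_sum _ fun k _ => (hπkmeas k a).const_mul _
  -- measurability of functions of `(s, a)`
  have hlift : ∀ h : S → A → ℝ, (∀ a, Measurable fun s => h s a) →
      Measurable fun x : S × A × ℝ => h x.1 x.2.1 := by
    intro h hh
    have h1 : Measurable fun p : S × A => h p.1 p.2 := measurable_from_prod_countable_left hh
    exact h1.comp (by fun_prop : Measurable fun x : S × A × ℝ => (x.1, x.2.1))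
  have hgm : ∀ a, Measurable fun s => ghat s a := fun a =>
    hghatmeas.comp (by fun_prop : Measurable fun s : S => (s, a))
  have hqm : ∀ a, Measurable fun s => q s a := by
    intro a
    let κ : Kernel S ℝ :=
      ⟨fun s => pR s a, hRmeas.comp (by fun_prop : Measurable fun s : S => (s, a))⟩
    have : StronglyMeasurable fun s => ∫ r, r ∂ κ s :=
      StronglyMeasurable.integral_kernel (f := fun r : ℝ => r) stronglyMeasurable_id
    simp_rw [hq]
    exact this.measurable
  have hRabs : ∀ s a, ∀ᵐ r ∂ pR s a, |r| ≤ |Rmax| := fun s a => by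
    filter_upwards [hRbdd s a] with r hr
    rw [abs_of_nonneg hr.1]
    exact hr.2.trans (le_abs_self _)
  have hRint : ∀ s a, Integrable (fun r : ℝ => r) (pR s a) := fun s a => by
    have := hRprob s a
    exact Integrable.of_bound measurable_id.aestronglyMeasurable _ (hRabs s a)
  have hqb : ∀ s a, |q s a| ≤ |Rmax| := fun s a => by
    have := hRprob s a
    rw [hq]
    have := norm_integral_le_of_norm_le_const (f := fun r : ℝ => r) (hRabs s a)
    simpa using this
  have hB : ∀ s a, |ghat s a| ≤ |B| := fun s a => (hghatbdd s a).trans (le_abs_self _)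
  have hBπ : ∀ s a, |πhat s a| ≤ |Bπ| := fun s a => (hπhatbdd s a).trans (le_abs_self _)
  have key := obs_key pS pR hRprob hRmeas πstar hsmeas hsnn hρle
  let w : S → A → ℝ := fun s a => if πe s a = 0 then 0 else πe s a / πhat s a
  have hwm : ∀ a, Measurable fun s => w s a := fun a =>
    Measurable.ite (measurableSet_eq_fun (hπemeas a) measurable_const) measurable_const
      ((hπemeas a).div (hπhatmeas a))
  have hpos : ∀ s a, πe s a ≠ 0 → 0 < πe s a := fun s a h => lt_of_le_of_ne (hπenn s a) (Ne.symm h)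
  have hwb : ∀ s a, |w s a| ≤ 1 / δ := by
    intro s a
    by_cases h : πe s a = 0
    · simp only [w, h, if_true, abs_zero]; positivity
    · have h2 := hπhatlb s a (hpos s a h)
      simp only [w, h, if_false]
      rw [abs_of_nonneg (div_nonneg (hπenn s a) (hδ.le.trans h2))]
      exact div_le_div₀ zero_le_one (he1 s a) hδ h2
  let v : S → A → ℝ := fun s a => if πe s a = 0 then 0 else πe s a / (πhat s a * πstar s a)
  have hvm : ∀ a, Measurable fun s => v s a := fun a =>
    Measurable.ite (measurableSet_eq_fun (hπemeas a) measurable_const) measurable_const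
      ((hπemeas a).div ((hπhatmeas a).mul (hsmeas a)))
  have hvb : ∀ s a, |v s a| ≤ 1 / δ ^ 2 := by
    intro s a
    by_cases h : πe s a = 0
    · simp only [v, h, if_true, abs_zero]; positivity
    · have h2 := hπhatlb s a (hpos s a h)
      have h3 := hπstarlb s a (hpos s a h)
      simp only [v, h, if_false]
      rw [abs_of_nonneg (div_nonneg (hπenn s a)
        (mul_nonneg (hδ.le.trans h2) (hδ.le.trans h3)))]
      refine div_le_div₀ zero_le_one (he1 s a) (by positivity) ?_
      rw [sq]
      exact mul_le_mul h2 h3 hδ.le (hδ.le.trans h2)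
  have hwt : ∀ (h : S → A → ℝ) (M : ℝ), (∀ s a, |h s a| ≤ M) → ∀ s,
      |∑ a, πe s a * h s a| ≤ M := by
    intro h M hM s
    calc |∑ a, πe s a * h s a| ≤ ∑ a, |πe s a * h s a| := Finset.abs_sum_le_sum_abs _ _
      _ ≤ ∑ a, πe s a * M := Finset.sum_le_sum fun a _ => by
          rw [abs_mul, abs_of_nonneg (hπenn s a)]
          exact mul_le_mul_of_nonneg_left (hM s a) (hπenn s a)
      _ = M := by rw [← Finset.sum_mul, hπesum, one_mul]
  have hwtm : ∀ h : S → A → ℝ, (∀ a, Measurable fun s => h s a) →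
      Measurable fun x : S × A × ℝ => ∑ a, πe x.1 a * h x.1 a := by
    intro h hh
    exact Finset.measurable_sum _ fun a _ =>
      ((hπemeas a).comp measurable_fst).mul ((hh a).comp measurable_fst)
  -- the score, the target and the remainder
  let F1 : S × A × ℝ → ℝ := fun x =>
    w x.1 x.2.1 * (x.2.2 - ghat x.1 x.2.1) + ∑ a, πe x.1 a * ghat x.1 a
  let F2 : S × A × ℝ → ℝ := fun x => ∑ a, πe x.1 a * q x.1 a
  let F3 : S × A × ℝ → ℝ := fun x => v x.1 x.2.1 *
    ((πhat x.1 x.2.1 - πstar x.1 x.2.1) * (ghat x.1 x.2.1 - q x.1 x.2.1))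
  have hdm := hlift (fun s a => πhat s a - πstar s a) fun a => (hπhatmeas a).sub (hsmeas a)
  have hem := hlift (fun s a => ghat s a - q s a) fun a => (hgm a).sub (hqm a)
  have hdb : ∀ s a, |πhat s a - πstar s a| ≤ |Bπ| + 1 := fun s a =>
    (abs_sub _ _).trans (add_le_add (hBπ s a) (by rw [abs_of_nonneg (hsnn s a)]; exact hs1 s a))
  have heb : ∀ s a, |ghat s a - q s a| ≤ |B| + |Rmax| := fun s a =>
    (abs_sub _ _).trans (add_le_add (hB s a) (hqb s a))
  have hF1m : Measurable F1 :=
    ((hlift w hwm).mul (measurable_snd.snd.sub (hlift ghat hgm))).add (hwtm ghat hgm)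
  have hF3m : Measurable F3 := (hlift v hvm).mul (hdm.mul hem)
  obtain ⟨hprob, -, hF1i, hF1⟩ := key F1 hF1m (1 / δ * (|Rmax| + |B|) + |B|) (by
    intro s a
    filter_upwards [hRabs s a] with r hr
    refine (abs_add_le _ _).trans (add_le_add ?_ (hwt ghat _ hB s))
    rw [abs_mul]
    exact mul_le_mul (hwb s a) ((abs_sub _ _).trans (add_le_add hr (hB s a))) (abs_nonneg _)
      (by positivity))
  obtain ⟨-, -, hF2i, hF2⟩ := key F2 (hwtm q hqm) |Rmax|
    (fun s a => ae_of_all _ fun r => hwt q _ hqb s)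
  obtain ⟨-, -, -, hF12⟩ := key (F1 - F2) (hF1m.sub (hwtm q hqm))
    (1 / δ * (|Rmax| + |B|) + |B| + |Rmax|) (by
    intro s a
    filter_upwards [hRabs s a] with r hr
    refine (abs_sub _ _).trans (add_le_add ?_ (hwt q _ hqb s))
    refine (abs_add_le _ _).trans (add_le_add ?_ (hwt ghat _ hB s))
    rw [abs_mul]
    exact mul_le_mul (hwb s a) ((abs_sub _ _).trans (add_le_add hr (hB s a))) (abs_nonneg _)
      (by positivity))
  obtain ⟨-, -, -, hF3⟩ := key F3 hF3m (1 / δ ^ 2 * ((|Bπ| + 1) * (|B| + |Rmax|)))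
    (fun s a => ae_of_all _ fun r => by
      simp only [F3]
      rw [abs_mul, abs_mul]
      exact mul_le_mul (hvb s a) (mul_le_mul (hdb s a) (heb s a) (abs_nonneg _) (by positivity))
        (by positivity) (by positivity))
  have hJ2 : J = ∫ x, F2 x ∂ obsMeasure pS πstar pR := by
    rw [hF2, hJ]
    refine integral_congr_ae (ae_of_all _ fun s => ?_)
    have : ∀ a, ∫ r, F2 (s, a, r) ∂ pR s a = ∑ a, πe s a * q s a := fun a => by
      have := hRprob s a
      simp [F2]
    simp only [this]
    rw [← Finset.sum_mul, hρle, one_mul]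
  have hdiff : (∫ x, F1 x ∂ obsMeasure pS πstar pR) - J
      = ∫ x, F3 x ∂ obsMeasure pS πstar pR := by
    rw [hJ2, ← integral_sub hF1i hF2i]
    refine hF12.trans ?_
    rw [hF3]
    refine integral_congr_ae (ae_of_all _ fun s => ?_)
    have i12 : ∀ a, ∫ r, (F1 - F2) (s, a, r) ∂ pR s a
        = w s a * (q s a - ghat s a) + ((∑ b, πe s b * ghat s b) - ∑ b, πe s b * q s b) := by
      intro a
      have := hRprob s a
      have e : ∀ r, (F1 - F2) (s, a, r) = w s a * r +
          (- (w s a * ghat s a) + ((∑ b, πe s b * ghat s b) - ∑ b, πe s b * q s b)) := fun r => by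
        simp only [F1, F2, Pi.sub_apply]; ring
      simp only [e]
      rw [integral_add ((hRint s a).const_mul _) (integrable_const _), integral_const_mul, ← hq]
      simp only [integral_const, probReal_univ, one_smul]
      ring
    have i3 : ∀ a, ∫ r, F3 (s, a, r) ∂ pR s a
        = v s a * ((πhat s a - πstar s a) * (ghat s a - q s a)) := by
      intro a
      have := hRprob s a
      simp [F3]
    simp only [i12, i3, mul_add]
    rw [Finset.sum_add_distrib, ← Finset.sum_mul, hρle, one_mul, ← Finset.sum_sub_distrib,
      ← Finset.sum_add_distrib]
    refine Finset.sum_congr rfl fun a _ => ?_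
    by_cases h : πe s a = 0
    · simp [w, v, h]
    · have h2 : πhat s a ≠ 0 := (hδ.trans_le (hπhatlb s a (hpos s a h))).ne'
      have h3 : πstar s a ≠ 0 := (hov s a (hpos s a h)).ne'
      simp only [w, v, h, if_false]
      field_simp
      ring
  have hfin := obs_cs (obsMeasure pS πstar pR)
    (fun x => πhat x.1 x.2.1 - πstar x.1 x.2.1) (fun x => ghat x.1 x.2.1 - q x.1 x.2.1) F3
    (MemLp.of_bound hdm.aestronglyMeasurable (|Bπ| + 1) (ae_of_all _ fun x => hdb _ _))
    (MemLp.of_bound hem.aestronglyMeasurable (|B| + |Rmax|) (ae_of_all _ fun x => heb _ _))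
    (1 / δ ^ 2) (by positivity) (fun x => by
      simp only [F3]
      rw [abs_mul, abs_mul]
      exact mul_le_mul_of_nonneg_right (hvb _ _) (by positivity))
  rw [← hdiff] at hfin
  exact hfin
end
end

section
/- Under weak overlap, for every bounded measurable g: S×A → ℝ, the stratified variance objective V(g) := Σ_{k=1}^K ρ_k var_{π_k}[φ(s,a,r;g)] satisfies V(g) ≥ V*, and V(q) = V*, where V* = E_{π_*}[(π^e(a|s)/π_*(a|s))² σ_r²(s,a)] + var_{p_S}[v(s)]. That is, the true conditional mean reward q minimizes the stratified variance of the doubly robust score over all control variates. -/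
open MeasureTheory ProbabilityTheory BigOperators Filter
open scoped NNReal ENNReal

noncomputable section

/-- Bounded measurable real functions. -/
def BMfun {X : Type*} [MeasurableSpace X] (f : X → ℝ) : Prop :=
  Measurable f ∧ ∃ C, ∀ x, |f x| ≤ C

namespace BMfun
variable {X : Type*} [MeasurableSpace X] {f f' : X → ℝ}

theorem const (c : ℝ) : BMfun (fun _ : X => c) := ⟨measurable_const, |c|, fun _ => le_rfl⟩

theorem add (h : BMfun f) (h' : BMfun f') : BMfun (fun x => f x + f' x) := by
  obtain ⟨m, C, hC⟩ := h
  obtain ⟨m', C', hC'⟩ := h'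
  exact ⟨m.add m', C + C', fun x => (abs_add_le _ _).trans (add_le_add (hC x) (hC' x))⟩

theorem mul (h : BMfun f) (h' : BMfun f') : BMfun (fun x => f x * f' x) := by
  obtain ⟨m, C, hC⟩ := h
  obtain ⟨m', C', hC'⟩ := h'
  refine ⟨m.mul m', C * C', fun x => ?_⟩
  rw [abs_mul]
  exact mul_le_mul (hC x) (hC' x) (abs_nonneg _) ((abs_nonneg _).trans (hC x))

theorem sub (h : BMfun f) (h' : BMfun f') : BMfun (fun x => f x - f' x) := by
  have := h.add ((const (-1)).mul h')
  simpa [sub_eq_add_neg] using this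

theorem sq (h : BMfun f) : BMfun (fun x => f x ^ 2) := by
  simpa [pow_two] using h.mul h

theorem sum {ι : Type*} (s : Finset ι) {F : ι → X → ℝ} (h : ∀ i, BMfun (F i)) :
    BMfun (fun x => ∑ i ∈ s, F i x) := by
  classical
  induction s using Finset.induction_on with
  | empty => simpa using const 0
  | insert a s ha ih => simpa [Finset.sum_insert ha] using (h a).add ih

theorem integrable (h : BMfun f) (μ : Measure X) [IsFiniteMeasure μ] : Integrable f μ := by
  obtain ⟨m, C, hC⟩ := h
  exact Integrable.of_bound m.aestronglyMeasurable C (ae_of_all _ hC)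

end BMfun

section Obs
set_option linter.unusedSectionVars false
variable {S A : Type*} [MeasurableSpace S] [MeasurableSpace A] [Fintype A]
    [MeasurableSingletonClass A]

theorem obs_meas (π : S → A → ℝ) (hπ : ∀ a, Measurable fun s => π s a)
    (pR : S → A → Measure ℝ) (hRprob : ∀ s a, IsProbabilityMeasure (pR s a))
    (hRmeas : Measurable fun p : S × A => pR p.1 p.2) :
    Measurable fun s => ∑ a : A, ENNReal.ofReal (π s a) •
      (pR s a).map (fun r => ((s, a, r) : S × A × ℝ)) := by
  refine Measure.measurable_of_measurable_coe _ fun t ht => ?_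
  simp only [Measure.finsetSum_apply, Measure.smul_apply, smul_eq_mul]
  refine Finset.measurable_sum _ fun a _ => ?_
  refine (hπ a).ennreal_ofReal.mul ?_
  have hm : Measurable fun s => pR s a := hRmeas.comp (measurable_id.prodMk measurable_const)
  let κ : Kernel S ℝ := ⟨fun s => pR s a, hm⟩
  have : IsMarkovKernel κ := ⟨fun s => hRprob s a⟩
  have h1 : MeasurableSet ((fun p : S × ℝ => ((p.1, a, p.2) : S × A × ℝ)) ⁻¹' t) :=
    (measurable_fst.prodMk (measurable_const.prodMk measurable_snd)) ht
  have h2 := Kernel.measurable_kernel_prodMk_left (κ := κ) h1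
  convert h2 using 2 with s
  rw [Measure.map_apply (by fun_prop) ht]
  rfl

theorem obs_integral (pS : Measure S) [IsProbabilityMeasure pS]
    (π : S → A → ℝ) (hπ : ∀ a, Measurable fun s => π s a)
    (hnn : ∀ s a, 0 ≤ π s a) (hsum : ∀ s, ∑ a, π s a = 1)
    (pR : S → A → Measure ℝ) (hRprob : ∀ s a, IsProbabilityMeasure (pR s a))
    (hRmeas : Measurable fun p : S × A => pR p.1 p.2)
    (Rmax : ℝ) (hRbdd : ∀ s a, ∀ᵐ r ∂ pR s a, r ∈ Set.Icc (0 : ℝ) Rmax)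
    (F : S × A × ℝ → ℝ) (hF : Measurable F) (C : ℝ)
    (hC : ∀ s a r, r ∈ Set.Icc (0 : ℝ) Rmax → |F (s, a, r)| ≤ C) :
    ∫ x, F x ∂ obsMeasure pS π pR = ∫ s, ∑ a, π s a * ∫ r, F (s, a, r) ∂ pR s a ∂ pS := by
  let κ : Kernel S (S × A × ℝ) := ⟨_, obs_meas π hπ pR hRprob hRmeas⟩
  have hκ : ∀ s, κ s = ∑ a : A, ENNReal.ofReal (π s a) •
      (pR s a).map (fun r => ((s, a, r) : S × A × ℝ)) := fun s => rfl
  have hemb : ∀ s a, Measurable (fun r : ℝ => ((s, a, r) : S × A × ℝ)) := fun s a => by fun_prop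
  have : IsMarkovKernel κ := by
    refine ⟨fun s => ⟨?_⟩⟩
    rw [hκ]
    simp only [Measure.finsetSum_apply, Measure.smul_apply, smul_eq_mul]
    simp_rw [Measure.map_apply (hemb _ _) MeasurableSet.univ]
    simp [← ENNReal.ofReal_sum_of_nonneg (fun a _ => hnn s a), hsum]
  have hobs : obsMeasure pS π pR = κ ∘ₘ pS := rfl
  have hFb : ∀ s a, ∀ᵐ r ∂ pR s a, ‖F (s, a, r)‖ ≤ C := fun s a => by
    filter_upwards [hRbdd s a] with r hr using hC s a r hr
  have hset : MeasurableSet {x | ‖F x‖ ≤ C} := measurableSet_le hF.norm measurable_const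
  have hκb : ∀ s, ∀ᵐ x ∂ κ s, ‖F x‖ ≤ C := by
    intro s
    rw [hκ, ae_iff]
    simp only [Measure.finsetSum_apply, Measure.smul_apply, smul_eq_mul]
    refine Finset.sum_eq_zero fun a _ => ?_
    rw [show {x | ¬ ‖F x‖ ≤ C} = {x | ‖F x‖ ≤ C}ᶜ from rfl, Measure.map_apply (hemb s a) hset.compl]
    have := ae_iff.mp (hFb s a)
    exact mul_eq_zero_of_right _ this
  have hint : Integrable F (κ ∘ₘ pS) :=
    Integrable.of_bound hF.aestronglyMeasurable C
      (Measure.ae_comp_of_ae_ae hset (ae_of_all _ hκb))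
  have hcomp : ∫ x, F x ∂(κ ∘ₘ pS) = ∫ s, ∫ x, F x ∂ κ s ∂ pS := by
    rw [Measure.comp_eq_comp_const_apply] at hint ⊢
    rw [Kernel.integral_comp hint, Kernel.const_apply]
  rw [hobs, hcomp]
  refine integral_congr_ae (ae_of_all _ fun s => ?_)
  have hi : ∀ a, Integrable (fun r => F (s, a, r)) (pR s a) := fun a =>
    Integrable.of_bound (hF.comp (hemb s a)).aestronglyMeasurable C (hFb s a)
  simp only [hκ]
  rw [integral_finsetSum_measure]
  · refine Finset.sum_congr rfl fun a _ => ?_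
    rw [integral_smul_measure, integral_map (hemb s a).aemeasurable hF.aestronglyMeasurable,
      ENNReal.toReal_ofReal (hnn s a), smul_eq_mul]
  · intro a _
    refine Integrable.smul_measure ?_ ENNReal.ofReal_ne_top
    exact (integrable_map_measure hF.aestronglyMeasurable (hemb s a).aemeasurable).2 (hi a)


theorem mom_bm (pR : S → A → Measure ℝ) (hRprob : ∀ s a, IsProbabilityMeasure (pR s a))
    (hRmeas : Measurable fun p : S × A => pR p.1 p.2)
    (Rmax : ℝ) (hRbdd : ∀ s a, ∀ᵐ r ∂ pR s a, r ∈ Set.Icc (0 : ℝ) Rmax) (n : ℕ) (a : A) :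
    BMfun (fun s => ∫ r, r ^ n ∂ pR s a) := by
  have hm : Measurable fun s => pR s a := hRmeas.comp (measurable_id.prodMk measurable_const)
  let κ : Kernel S ℝ := ⟨fun s => pR s a, hm⟩
  have : IsMarkovKernel κ := ⟨fun s => hRprob s a⟩
  refine ⟨?_, Rmax ^ n, fun s => ?_⟩
  · have h : StronglyMeasurable (fun r : ℝ => r ^ n) := by fun_prop
    exact (h.integral_kernel (κ := κ)).measurable
  · have := hRprob s a
    have h := norm_integral_le_of_norm_le_const (μ := pR s a) (f := fun r => r ^ n)
      (C := Rmax ^ n) (by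
        filter_upwards [hRbdd s a] with r hr
        rw [norm_pow, Real.norm_of_nonneg hr.1]
        exact pow_le_pow_left₀ hr.1 hr.2 n)
    simpa using h

theorem memLp_id (pR : S → A → Measure ℝ) (hRprob : ∀ s a, IsProbabilityMeasure (pR s a))
    (Rmax : ℝ) (hRbdd : ∀ s a, ∀ᵐ r ∂ pR s a, r ∈ Set.Icc (0 : ℝ) Rmax) (s : S) (a : A) :
    MemLp (id : ℝ → ℝ) 2 (pR s a) := by
  have := hRprob s a
  refine MemLp.of_bound aestronglyMeasurable_id Rmax ?_
  filter_upwards [hRbdd s a] with r hr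
  rw [id, Real.norm_of_nonneg hr.1]
  exact hr.2

theorem inner_sq (pR : S → A → Measure ℝ) (hRprob : ∀ s a, IsProbabilityMeasure (pR s a))
    (Rmax : ℝ) (hRbdd : ∀ s a, ∀ᵐ r ∂ pR s a, r ∈ Set.Icc (0 : ℝ) Rmax) (s : S) (a : A)
    (w b : ℝ) :
    ∫ r, (w * r + b) ^ 2 ∂ pR s a =
      w ^ 2 * variance id (pR s a) + (w * ∫ r, r ∂ pR s a + b) ^ 2 := by
  have := hRprob s a
  have h2 := memLp_id pR hRprob Rmax hRbdd s a
  have hi : Integrable (fun r : ℝ => r) (pR s a) := h2.integrable (by norm_num)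
  have hi2 : Integrable (fun r : ℝ => r ^ 2) (pR s a) := h2.integrable_sq
  rw [variance_eq_sub h2]
  have : ∀ r : ℝ, (w * r + b) ^ 2 = w ^ 2 * r ^ 2 + 2 * w * b * r + b ^ 2 := fun r => by ring
  simp_rw [this]
  rw [integral_add (f := fun r => w ^ 2 * r ^ 2 + 2 * w * b * r)
    ((hi2.const_mul _).add (hi.const_mul _)) (integrable_const _),
    integral_add (hi2.const_mul _) (hi.const_mul _),
    integral_const_mul, integral_const_mul]
  simp
  ring

theorem inner_lin (pR : S → A → Measure ℝ) (hRprob : ∀ s a, IsProbabilityMeasure (pR s a))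
    (Rmax : ℝ) (hRbdd : ∀ s a, ∀ᵐ r ∂ pR s a, r ∈ Set.Icc (0 : ℝ) Rmax) (s : S) (a : A)
    (w b : ℝ) :
    ∫ r, (w * r + b) ∂ pR s a = w * ∫ r, r ∂ pR s a + b := by
  have := hRprob s a
  have h2 := memLp_id pR hRprob Rmax hRbdd s a
  have hi : Integrable (fun r : ℝ => r) (pR s a) := h2.integrable (by norm_num)
  rw [integral_add (hi.const_mul _) (integrable_const _), integral_const_mul]
  simp

theorem meas_uncurry (f : S → A → ℝ) (hf : ∀ a, Measurable fun s => f s a) :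
    Measurable fun p : S × A => f p.1 p.2 :=
  measurable_from_prod_countable_left hf

theorem unif_bound (f : S → A → ℝ) (hf : ∀ a, BMfun fun s => f s a) :
    ∃ C, ∀ s a, |f s a| ≤ C := by
  choose C hC using fun a => (hf a).2
  refine ⟨∑ a, |C a|, fun s a => (hC a s).trans ((le_abs_self _).trans ?_)⟩
  exact Finset.single_le_sum (f := fun a => |C a|) (fun _ _ => abs_nonneg _) (Finset.mem_univ a)

theorem obs_variance (pS : Measure S) [IsProbabilityMeasure pS]
    (π : S → A → ℝ) (hπ : ∀ a, Measurable fun s => π s a)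
    (hnn : ∀ s a, 0 ≤ π s a) (hsum : ∀ s, ∑ a, π s a = 1)
    (pR : S → A → Measure ℝ) (hRprob : ∀ s a, IsProbabilityMeasure (pR s a))
    (hRmeas : Measurable fun p : S × A => pR p.1 p.2)
    (Rmax : ℝ) (hRbdd : ∀ s a, ∀ᵐ r ∂ pR s a, r ∈ Set.Icc (0 : ℝ) Rmax)
    (q : S → A → ℝ) (hq : ∀ s a, q s a = ∫ r, r ∂ pR s a)
    (σ2 : S → A → ℝ) (hσ2 : ∀ s a, σ2 s a = variance id (pR s a))
    (w h : S → A → ℝ) (hw : ∀ a, BMfun fun s => w s a) (hh : ∀ a, BMfun fun s => h s a)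
    (φ : S × A × ℝ → ℝ) (hφ : ∀ x, φ x = w x.1 x.2.1 * x.2.2 + h x.1 x.2.1) :
    variance φ (obsMeasure pS π pR) =
      ∫ s, ∑ a, π s a * (w s a ^ 2 * σ2 s a + (w s a * q s a + h s a -
        ∫ s, ∑ a, π s a * (w s a * q s a + h s a) ∂ pS) ^ 2) ∂ pS := by
  obtain ⟨W, hW⟩ := unif_bound w hw
  obtain ⟨H, hH⟩ := unif_bound h hh
  have hwm := meas_uncurry w fun a => (hw a).1
  have hhm := meas_uncurry h fun a => (hh a).1
  have hp : Measurable fun x : S × A × ℝ => (x.1, x.2.1) := by fun_prop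
  have hφm : Measurable φ := by
    have : φ = fun x => w x.1 x.2.1 * x.2.2 + h x.1 x.2.1 := funext hφ
    rw [this]
    exact ((hwm.comp hp).mul (by fun_prop)).add (hhm.comp hp)
  have hφb : ∀ s a r, r ∈ Set.Icc (0 : ℝ) Rmax → |φ (s, a, r)| ≤ W * Rmax + H := by
    intro s a r hr
    rw [hφ]
    refine (abs_add_le _ _).trans (add_le_add ?_ (hH s a))
    rw [abs_mul, abs_of_nonneg (a := (s, a, r).2.2) hr.1]
    exact mul_le_mul (hW s a) hr.2 hr.1 ((abs_nonneg _).trans (hW s a))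
  have hE : ∫ x, φ x ∂ obsMeasure pS π pR = ∫ s, ∑ a, π s a * (w s a * q s a + h s a) ∂ pS := by
    rw [obs_integral pS π hπ hnn hsum pR hRprob hRmeas Rmax hRbdd φ hφm _ hφb]
    simp_rw [hφ, inner_lin pR hRprob Rmax hRbdd, hq]
  rw [variance_eq_integral hφm.aemeasurable, hE]
  set e := ∫ s, ∑ a, π s a * (w s a * q s a + h s a) ∂ pS
  rw [obs_integral pS π hπ hnn hsum pR hRprob hRmeas Rmax hRbdd (fun x => (φ x - e) ^ 2)
    (by fun_prop) ((W * Rmax + H + |e|) ^ 2) ?_]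
  · simp_rw [hφ, add_sub_assoc, inner_sq pR hRprob Rmax hRbdd, hq, hσ2]
  · intro s a r hr
    rw [abs_pow]
    refine pow_le_pow_left₀ (abs_nonneg _) ?_ 2
    exact (abs_sub _ _).trans (add_le_add (hφb s a r hr) le_rfl)

end Obs

/-- Under weak overlap (with `π_*` bounded away from `0` on
`{π^e > 0}`), for every bounded measurable control variate `g`, the stratified
variance objective `V(g) = ∑ k, ρ k * var_{π_k}[φ(·;g)]` satisfies `V(g) ≥ V*`, and
`V(q) = V*`, where
`V* = E_{π_*}[(π^e/π_*)² σ_r²(s,a)] + var_{p_S}[v(s)]`: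
the true conditional mean reward `q` minimizes the stratified variance of the doubly
robust score over all control variates. -/
theorem stmt16 {S A : Type*} [MeasurableSpace S] [MeasurableSpace A] [Fintype A]
    [MeasurableSingletonClass A]
    (K : ℕ) (pS : Measure S) [IsProbabilityMeasure pS]
    (pR : S → A → Measure ℝ) (hRprob : ∀ s a, IsProbabilityMeasure (pR s a))
    (hRmeas : Measurable fun p : S × A => pR p.1 p.2)
    (Rmax : ℝ) (hRbdd : ∀ s a, ∀ᵐ r ∂ pR s a, r ∈ Set.Icc (0 : ℝ) Rmax)
    (πk : Fin K → S → A → ℝ) (πe : S → A → ℝ)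
    (hπkmeas : ∀ k a, Measurable fun s => πk k s a)
    (hπemeas : ∀ a, Measurable fun s => πe s a)
    (hπknn : ∀ k s a, 0 ≤ πk k s a) (hπksum : ∀ k s, ∑ a, πk k s a = 1)
    (hπenn : ∀ s a, 0 ≤ πe s a) (hπesum : ∀ s, ∑ a, πe s a = 1)
    (ρ : Fin K → ℝ) (hρpos : ∀ k, 0 < ρ k) (hρsum : ∑ k, ρ k = 1)
    (πstar : S → A → ℝ) (hπstar : ∀ s a, πstar s a = ∑ k, ρ k * πk k s a)
    -- weak overlap, with `π_*` bounded away from zero on `{π^e > 0}`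
    (hov : ∀ s a, 0 < πe s a → 0 < πstar s a)
    (δ : ℝ) (hδ : 0 < δ) (hπstarlb : ∀ s a, 0 < πe s a → δ ≤ πstar s a)
    -- true mean reward, conditional variance, value function
    (q : S → A → ℝ) (hq : ∀ s a, q s a = ∫ r, r ∂ pR s a)
    (σ2 : S → A → ℝ) (hσ2 : ∀ s a, σ2 s a = variance id (pR s a))
    (v : S → ℝ) (hv : ∀ s, v s = ∑ a, πe s a * q s a)
    -- the efficiency bound
    (Vstar : ℝ)
    (hVstar : Vstar =
      (∫ x : S × A × ℝ,
          (if πe x.1 x.2.1 = 0 then 0 else πe x.1 x.2.1 / πstar x.1 x.2.1) ^ 2 *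
            σ2 x.1 x.2.1
        ∂ obsMeasure pS πstar pR) + variance v pS)
    -- bounded measurable control variate
    (g : S → A → ℝ) (hgmeas : Measurable fun p : S × A => g p.1 p.2)
    (B : ℝ) (hgbdd : ∀ s a, |g s a| ≤ B)
    -- the doubly robust scores with control variates `g` and `q`
    (φg φq : S × A × ℝ → ℝ)
    (hφg : ∀ x : S × A × ℝ, φg x =
      (if πe x.1 x.2.1 = 0 then 0 else πe x.1 x.2.1 / πstar x.1 x.2.1) *
        (x.2.2 - g x.1 x.2.1) + ∑ a, πe x.1 a * g x.1 a)
    (hφq : ∀ x : S × A × ℝ, φq x =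
      (if πe x.1 x.2.1 = 0 then 0 else πe x.1 x.2.1 / πstar x.1 x.2.1) *
        (x.2.2 - q x.1 x.2.1) + ∑ a, πe x.1 a * q x.1 a) :
    Vstar ≤ ∑ k, ρ k * variance φg (obsMeasure pS (πk k) pR) ∧
    (∑ k, ρ k * variance φq (obsMeasure pS (πk k) pR)) = Vstar := by
  -- density ratios
  let w : S → A → ℝ := fun s a => if πe s a = 0 then 0 else πe s a / πstar s a
  have hwdef : ∀ s a, (if πe s a = 0 then 0 else πe s a / πstar s a) = w s a := fun _ _ => rfl
  have hle1 : ∀ (p : S → A → ℝ), (∀ s a, 0 ≤ p s a) → (∀ s, ∑ a, p s a = 1) →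
      ∀ s a, |p s a| ≤ 1 := fun p h0 h1 s a => by
    rw [abs_of_nonneg (h0 s a), ← h1 s]
    exact Finset.single_le_sum (f := fun a => p s a) (fun a _ => h0 s a) (Finset.mem_univ a)
  have bπe : ∀ a, BMfun fun s => πe s a := fun a => ⟨hπemeas a, 1, fun s => hle1 πe hπenn hπesum s a⟩
  have bπk : ∀ k a, BMfun fun s => πk k s a := fun k a =>
    ⟨hπkmeas k a, 1, fun s => hle1 _ (hπknn k) (hπksum k) s a⟩
  have hstarnn : ∀ s a, 0 ≤ πstar s a := fun s a => by
    rw [hπstar]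
    exact Finset.sum_nonneg fun k _ => mul_nonneg (hρpos k).le (hπknn k s a)
  have hstarsum : ∀ s, ∑ a, πstar s a = 1 := fun s => by
    simp_rw [hπstar]
    rw [Finset.sum_comm]
    simp_rw [← Finset.mul_sum, hπksum, mul_one, hρsum]
  have hstarm : ∀ a, Measurable fun s => πstar s a := fun a => by
    simp_rw [hπstar]
    exact (BMfun.sum _ fun k => (BMfun.const (ρ k)).mul (bπk k a)).1
  have bw : ∀ a, BMfun fun s => w s a := fun a => by
    refine ⟨Measurable.ite (hπemeas a (measurableSet_singleton 0)) measurable_const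
      ((hπemeas a).div (hstarm a)), 1 / δ, fun s => ?_⟩
    by_cases h0 : πe s a = 0
    · simp only [w, h0, if_true, abs_zero]
      positivity
    · have hp : 0 < πe s a := lt_of_le_of_ne (hπenn s a) (Ne.symm h0)
      simp only [w, h0, if_false]
      rw [abs_div, abs_of_pos (hov s a hp)]
      exact div_le_div₀ zero_le_one (hle1 πe hπenn hπesum s a) hδ (hπstarlb s a hp)
  have hws : ∀ s a, πstar s a * w s a = πe s a := fun s a => by
    by_cases h0 : πe s a = 0
    · simp [w, h0]
    · have hp : 0 < πe s a := lt_of_le_of_ne (hπenn s a) (Ne.symm h0)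
      simp only [w, h0, if_false]
      exact mul_div_cancel₀ _ (hov s a hp).ne'
  have bq : ∀ a, BMfun fun s => q s a := fun a => by
    simpa [hq] using mom_bm pR hRprob hRmeas Rmax hRbdd 1 a
  have bσ : ∀ a, BMfun fun s => σ2 s a := fun a => by
    have := (mom_bm pR hRprob hRmeas Rmax hRbdd 2 a).sub (bq a).sq
    convert this using 2 with s
    have := hRprob s a
    rw [hσ2, variance_eq_sub (memLp_id pR hRprob Rmax hRbdd s a), hq]
    rfl
  have bg : ∀ a, BMfun fun s => g s a := fun a =>
    ⟨hgmeas.comp (measurable_id.prodMk measurable_const), B, fun s => hgbdd s a⟩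
  have bv : BMfun v := by
    have : v = fun s => ∑ a, πe s a * q s a := funext hv
    rw [this]
    exact BMfun.sum _ fun a => (bπe a).mul (bq a)
  -- the noise part
  have bN : ∀ k, BMfun fun s => ∑ a, πk k s a * (w s a ^ 2 * σ2 s a) := fun k =>
    BMfun.sum _ fun a => (bπk k a).mul ((bw a).sq.mul (bσ a))
  have hN : ∫ x : S × A × ℝ, (if πe x.1 x.2.1 = 0 then 0 else πe x.1 x.2.1 / πstar x.1 x.2.1) ^ 2 *
            σ2 x.1 x.2.1 ∂ obsMeasure pS πstar pR =
      ∑ k, ρ k * ∫ s, ∑ a, πk k s a * (w s a ^ 2 * σ2 s a) ∂ pS := by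
    simp_rw [hwdef]
    have bws : ∀ a, BMfun fun s => w s a ^ 2 * σ2 s a := fun a => (bw a).sq.mul (bσ a)
    obtain ⟨C, hC⟩ := unif_bound (fun s a => w s a ^ 2 * σ2 s a) bws
    rw [obs_integral pS πstar hstarm hstarnn hstarsum pR hRprob hRmeas Rmax hRbdd
      (fun x => w x.1 x.2.1 ^ 2 * σ2 x.1 x.2.1)
      ((meas_uncurry (fun s a => w s a ^ 2 * σ2 s a) fun a => (bws a).1).comp
        (g := fun p : S × A => w p.1 p.2 ^ 2 * σ2 p.1 p.2)
        (f := fun x : S × A × ℝ => (x.1, x.2.1)) (by fun_prop)) C (fun s a r _ => hC s a)]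
    simp_rw [← integral_const_mul]
    rw [← integral_finsetSum _ fun k _ => ((bN k).integrable pS).const_mul (ρ k)]
    refine integral_congr_ae (ae_of_all _ fun s => ?_)
    simp only [integral_const, probReal_univ, one_smul, hπstar, Finset.sum_mul, Finset.mul_sum]
    rw [Finset.sum_comm]
    exact Finset.sum_congr rfl fun k _ => Finset.sum_congr rfl fun a _ => by ring
  rw [hN] at hVstar
  have hvar : variance v pS = ∫ s, (v s - ∫ s, v s ∂ pS) ^ 2 ∂ pS :=
    variance_eq_integral bv.1.aemeasurable
  -- variance of a score
  have key : ∀ (f : S → A → ℝ), (∀ a, BMfun fun s => f s a) → ∀ φ : S × A × ℝ → ℝ,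
      (∀ x : S × A × ℝ, φ x =
        (if πe x.1 x.2.1 = 0 then 0 else πe x.1 x.2.1 / πstar x.1 x.2.1) *
        (x.2.2 - f x.1 x.2.1) + ∑ a, πe x.1 a * f x.1 a) → ∀ k,
      variance φ (obsMeasure pS (πk k) pR) =
        ∫ s, ∑ a, πk k s a * (w s a ^ 2 * σ2 s a) ∂ pS +
        ∫ s, ∑ a, πk k s a * (w s a * (q s a - f s a) + ∑ a, πe s a * f s a -
          ∫ s, ∑ a, πk k s a * (w s a * (q s a - f s a) + ∑ a, πe s a * f s a) ∂ pS) ^ 2 ∂ pS := by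
    intro f bf φ hφ k
    have bF : BMfun fun s => ∑ a, πe s a * f s a := BMfun.sum _ fun a => (bπe a).mul (bf a)
    rw [obs_variance pS (πk k) (hπkmeas k) (hπknn k) (hπksum k) pR hRprob hRmeas Rmax hRbdd q hq
      σ2 hσ2 w (fun s a => ∑ a, πe s a * f s a - w s a * f s a) bw
      (fun a => bF.sub ((bw a).mul (bf a))) φ (fun x => by rw [hφ, hwdef]; ring)]
    have e1 : ∀ s a, w s a * q s a + (∑ a, πe s a * f s a - w s a * f s a) =
      w s a * (q s a - f s a) + ∑ a, πe s a * f s a := fun s a => by ring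
    simp_rw [e1]
    rw [← integral_add ((bN k).integrable pS)]
    · simp_rw [← Finset.sum_add_distrib, mul_add]
    · exact (BMfun.sum _ fun a => (bπk k a).mul
        ((((bw a).mul ((bq a).sub (bf a))).add bF).sub (BMfun.const _)).sq).integrable pS
  constructor
  · simp_rw [key g bg φg hφg]
    have bG : BMfun fun s => ∑ a, πe s a * g s a := BMfun.sum _ fun a => (bπe a).mul (bg a)
    let X : Fin K → S → ℝ := fun k s =>
      ∑ a, πk k s a * (w s a * (q s a - g s a) + ∑ a, πe s a * g s a)
    have bX : ∀ k, BMfun (X k) := fun k => BMfun.sum _ fun a => (bπk k a).mul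
        (((bw a).mul ((bq a).sub (bg a))).add bG)
    have hXv : ∀ s, ∑ k, ρ k * X k s = v s := by
      intro s
      have : ∑ k, ρ k * X k s =
          ∑ a, πstar s a * (w s a * (q s a - g s a) + ∑ a, πe s a * g s a) := by
        simp only [X, hπstar, Finset.sum_mul]
        simp_rw [Finset.mul_sum]
        rw [Finset.sum_comm]
        simp_rw [mul_assoc]
      rw [this]
      simp_rw [mul_add, Finset.sum_add_distrib, ← Finset.sum_mul, hstarsum, one_mul, ← mul_assoc,
        hws, hv, ← Finset.sum_add_distrib]
      exact Finset.sum_congr rfl fun a _ => by ring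
    have hXe : ∑ k, ρ k * ∫ s, X k s ∂ pS = ∫ s, v s ∂ pS := by
      simp_rw [← hXv, ← integral_const_mul]
      rw [integral_finsetSum _ fun k _ => ((bX k).integrable pS).const_mul (ρ k)]
    simp_rw [mul_add, Finset.sum_add_distrib]
    rw [hVstar, hvar]
    refine add_le_add le_rfl ?_
    simp_rw [← integral_const_mul]
    have bY : ∀ k (c : ℝ), BMfun fun s => ρ k * ∑ a, πk k s a *
        (w s a * (q s a - g s a) + ∑ a, πe s a * g s a - c) ^ 2 := fun k c =>
      (BMfun.const _).mul (BMfun.sum _ fun a => (bπk k a).mul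
        ((((bw a).mul ((bq a).sub (bg a))).add bG).sub (BMfun.const _)).sq)
    rw [← integral_finsetSum _ fun k _ => (bY k _).integrable pS]
    refine integral_mono ((bv.sub (BMfun.const _)).sq.integrable pS)
      ((BMfun.sum _ fun k => bY k _).integrable pS) fun s => ?_
    dsimp only
    calc (v s - ∫ s, v s ∂ pS) ^ 2 = (∑ k, ρ k * (X k s - ∫ s, X k s ∂ pS)) ^ 2 := by
          rw [← hXe, ← hXv, ← Finset.sum_sub_distrib]
          simp_rw [mul_sub]
      _ ≤ ∑ k, ρ k * (X k s - ∫ s, X k s ∂ pS) ^ 2 :=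
          Real.pow_arith_mean_le_arith_mean_pow_of_even _ _ _ (fun k _ => (hρpos k).le) hρsum
            even_two
      _ ≤ _ := by
          refine Finset.sum_le_sum fun k _ => mul_le_mul_of_nonneg_left ?_ (hρpos k).le
          have h1 : X k s - ∫ s, X k s ∂ pS = ∑ a, πk k s a *
              (w s a * (q s a - g s a) + ∑ a, πe s a * g s a - ∫ s, X k s ∂ pS) := by
            simp_rw [mul_sub _ _ (∫ s, X k s ∂ pS)]
            rw [Finset.sum_sub_distrib, ← Finset.sum_mul, hπksum, one_mul]
          have h2 : ∫ s, (∑ a, πk k s a * (w s a * (q s a - g s a)) +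
              ∑ a, πk k s a * ∑ a, πe s a * g s a) ∂ pS = ∫ s, X k s ∂ pS := by
            simp only [X, mul_add, Finset.sum_add_distrib]
          rw [h1, h2]
          exact Real.pow_arith_mean_le_arith_mean_pow_of_even _ _ _ (fun a _ => hπknn k s a)
            (hπksum k s) even_two
  · simp_rw [key q bq φq hφq]
    simp_rw [sub_self, mul_zero, zero_add, ← Finset.sum_mul, hπksum, one_mul, ← hv, ← hvar,
      mul_add, Finset.sum_add_distrib, ← Finset.sum_mul, hρsum, one_mul]
    exact hVstar.symm
end
end
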